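/- Let F and G be smooth cubics in ℂ[X,Y,Z] whose common projective zero set consists of exactly nine distinct points p₁,…,p₉ of ℙ², with F and G meeting transversally at each of these points. Then for every integer k with 2 ≤ k ≤ 9 there exists a cubic H that vanishes at each of the points p_{k+1},…,p₉ and does not vanish at any of the points p₁,…,p_k. -/

import Mathlib

open MvPolynomial

/-- The gradient of a polynomial in `ℂ[X,Y,Z]` at a point of `ℂ³`. -/
noncomputable def grad (F : MvPolynomial (Fin 3) ℂ) (v : Fin 3 → ℂ) : Fin 3 → ℂ :=
  fun i => eval v (pderiv i F)

/-- A cubic: a nonzero homogeneous polynomial of degree 3 in `ℂ[X,Y,Z]`. -/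
def IsCubic (F : MvPolynomial (Fin 3) ℂ) : Prop :=
  F ≠ 0 ∧ F.IsHomogeneous 3

/-- A smooth cubic: `(0,0,0)` is the only common zero in `ℂ³` of the three
partial derivatives. -/
def SmoothCubic (F : MvPolynomial (Fin 3) ℂ) : Prop :=
  IsCubic F ∧ ∀ v : Fin 3 → ℂ, grad F v = 0 → v = 0

/-- `F` and `G` meet transversally at (the projective point represented by) `v`:
their gradients at `v` are linearly independent over `ℂ`. -/
def Transverse (F G : MvPolynomial (Fin 3) ℂ) (v : Fin 3 → ℂ) : Prop :=
  LinearIndependent ℂ ![grad F v, grad G v]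

/-- Two nonzero vectors of `ℂ³` represent the same point of `ℙ²`. -/
def SameProjPt (u v : Fin 3 → ℂ) : Prop :=
  ∃ c : ℂ, c ≠ 0 ∧ c • u = v

/-- The common projective zero set of `F` and `G` consists of exactly the nine
distinct points of `ℙ²` represented by `p 0, …, p 8`. -/
def NinePoints (F G : MvPolynomial (Fin 3) ℂ) (p : Fin 9 → Fin 3 → ℂ) : Prop :=
  (∀ i, p i ≠ 0) ∧
  (∀ i j, i ≠ j → ¬ SameProjPt (p i) (p j)) ∧
  (∀ i, eval (p i) F = 0 ∧ eval (p i) G = 0) ∧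
  (∀ v : Fin 3 → ℂ, v ≠ 0 → eval v F = 0 → eval v G = 0 → ∃ i, SameProjPt (p i) v)

open scoped Polynomial Matrix

/-! ### Vectors in `ℂ³` and linear forms -/

/-- The linear form `x ↦ w ⬝ᵥ x`. -/
noncomputable def linForm (w : Fin 3 → ℂ) : MvPolynomial (Fin 3) ℂ :=
  ∑ i, MvPolynomial.C (w i) * MvPolynomial.X i

lemma eval_linForm (w x : Fin 3 → ℂ) : MvPolynomial.eval x (linForm w) = w ⬝ᵥ x := by
  simp [linForm, dotProduct]

lemma linForm_isHomogeneous (w : Fin 3 → ℂ) : (linForm w).IsHomogeneous 1 := by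
  refine MvPolynomial.IsHomogeneous.sum _ _ _ fun i _ => ?_
  simpa using (MvPolynomial.isHomogeneous_C (Fin 3) (w i)).mul (MvPolynomial.isHomogeneous_X ℂ i)

lemma eval_smul_eq_zero {F : MvPolynomial (Fin 3) ℂ} {d : ℕ} (hF : F.IsHomogeneous d)
    {v : Fin 3 → ℂ} (hv : MvPolynomial.eval v F = 0) (c : ℂ) :
    MvPolynomial.eval (c • v) F = 0 := by
  have h : MvPolynomial.eval (c • v) F = c ^ d * MvPolynomial.eval v F := by
    rw [MvPolynomial.eval_eq, MvPolynomial.eval_eq, Finset.mul_sum]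
    refine Finset.sum_congr rfl fun m hm => ?_
    have hd : ∑ i ∈ m.support, m i = d := by
      rw [← hF (MvPolynomial.mem_support_iff.mp hm)]
      simp [Finsupp.weight_apply, Finsupp.sum]
    simp only [Pi.smul_apply, smul_eq_mul, mul_pow, Finset.prod_mul_distrib,
      Finset.prod_pow_eq_pow_sum, hd]
    ring
  rw [h, hv, mul_zero]

lemma exists_eq_smul_of_cross_eq_zero {a b : Fin 3 → ℂ} (h : a ⨯₃ b = 0) (hb : b ≠ 0) :
    ∃ t : ℂ, a = t • b := by
  by_contra! hab
  refine (crossProduct_ne_zero_iff_linearIndependent.mpr ?_ : b ⨯₃ a ≠ 0) ?_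
  · exact (LinearIndependent.pair_iff' hb).mpr fun t ht => hab t ht.symm
  · rw [← cross_anticomm, h, neg_zero]

lemma NinePoints.cross_ne_zero {F G : MvPolynomial (Fin 3) ℂ} {p : Fin 9 → Fin 3 → ℂ}
    (hp : NinePoints F G p) {i j : Fin 9} (hij : i ≠ j) : p i ⨯₃ p j ≠ 0 := by
  intro h
  obtain ⟨t, ht⟩ := exists_eq_smul_of_cross_eq_zero h (hp.1 j)
  refine hp.2.1 j i hij.symm ⟨t, ?_, ht.symm⟩
  rintro rfl
  exact hp.1 i (by simpa using ht)

lemma exists_dotProduct_eq_zero_ne_zero {a b : Fin 3 → ℂ} (h : a ⨯₃ b ≠ 0) :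
    ∃ w : Fin 3 → ℂ, w ⬝ᵥ b = 0 ∧ w ⬝ᵥ a ≠ 0 := by
  obtain ⟨k, hk⟩ := Function.ne_iff.mp h
  refine ⟨b ⨯₃ Pi.single k 1, ?_, ?_⟩
  · rw [dotProduct_comm, dot_self_cross]
  · rw [dotProduct_comm, triple_product_permutation, triple_product_permutation]
    simpa using hk

/-! ### Rational curves meeting the common zero set too often -/

/-- The common zero set of `F` and `G`, being finite, is not met by a parametrized curve of
degree `n` at more than `3 * n` parameters. -/
lemma NinePoints.false_of_curve {F G : MvPolynomial (Fin 3) ℂ} {p : Fin 9 → Fin 3 → ℂ}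
    (hp : NinePoints F G p) (hF : IsCubic F) (hG : IsCubic G)
    (φ : Fin 3 → ℂ[X]) {n : ℕ} (hφ : ∀ i, (φ i).natDegree ≤ n)
    (T : Finset ℂ) (hT : 3 * n < T.card)
    (hTp : ∀ t ∈ T, ∃ (i : Fin 9) (c : ℂ), (fun k => (φ k).eval t) = c • p i)
    (S : Set ℂ) (hS : S.Infinite) (hS0 : ∀ s ∈ S, (fun k => (φ k).eval s) ≠ 0)
    (hSinj : ∀ s ∈ S, ∀ t ∈ S,
      (fun k => (φ k).eval s) ⨯₃ (fun k => (φ k).eval t) = 0 → s = t) : False := by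
  have eval_aeval (H : MvPolynomial (Fin 3) ℂ) (t : ℂ) :
      (MvPolynomial.aeval φ H).eval t = MvPolynomial.eval (fun k => (φ k).eval t) H := by
    rw [← Polynomial.coe_evalRingHom, MvPolynomial.aeval_def, MvPolynomial.hom_eval₂]
    have : (Polynomial.evalRingHom t).comp (algebraMap ℂ ℂ[X]) = RingHom.id ℂ := by
      ext; simp
    rw [this]
    rfl
  have vanish (H : MvPolynomial (Fin 3) ℂ) (hH : IsCubic H)
      (hpH : ∀ i, MvPolynomial.eval (p i) H = 0) (t : ℂ) :
      MvPolynomial.eval (fun k => (φ k).eval t) H = 0 := by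
    have h0 : MvPolynomial.aeval φ H = 0 := by
      refine Polynomial.eq_zero_of_natDegree_lt_card_of_eval_eq_zero' _ T (fun t ht => ?_)
        ((MvPolynomial.aeval_natDegree_le H hH.2.totalDegree_le φ hφ).trans_lt hT)
      obtain ⟨i, c, hi⟩ := hTp t ht
      rw [eval_aeval, hi]
      exact eval_smul_eq_zero hH.2 (hpH i) c
    rw [← eval_aeval, h0, Polynomial.eval_zero]
  have hex (t : ℂ) : ∃ i, t ∈ S → SameProjPt (p i) (fun k => (φ k).eval t) := by
    by_cases ht : t ∈ S
    · obtain ⟨i, hi⟩ := hp.2.2.2 _ (hS0 t ht) (vanish F hF (fun i => (hp.2.2.1 i).1) t)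
        (vanish G hG (fun i => (hp.2.2.1 i).2) t)
      exact ⟨i, fun _ => hi⟩
    · exact ⟨0, fun h => absurd h ht⟩
  choose f hf using hex
  obtain ⟨s, hs, t, ht, hne, hst⟩ := hS.exists_ne_map_eq_of_mapsTo
    (f := f) (t := Set.univ) (fun _ _ => Set.mem_univ _) Set.finite_univ
  obtain ⟨a, -, ha⟩ := hf s hs
  obtain ⟨b, -, hb⟩ := hf t ht
  refine hne (hSinj s hs t ht ?_)
  rw [← ha, ← hb, hst]
  simp

/-- A line contains at most three of the nine points. -/
lemma NinePoints.card_line_le {F G : MvPolynomial (Fin 3) ℂ} {p : Fin 9 → Fin 3 → ℂ}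
    (hp : NinePoints F G p) (hF : IsCubic F) (hG : IsCubic G) {w : Fin 3 → ℂ} (hw : w ≠ 0) :
    (Finset.univ.filter fun i => w ⬝ᵥ p i = 0).card ≤ 3 := by
  classical
  by_contra! hcard
  obtain ⟨i₀, hi₀⟩ := Finset.card_pos.mp (Nat.zero_lt_of_lt hcard)
  replace hi₀ : w ⬝ᵥ p i₀ = 0 := by simpa using hi₀
  obtain ⟨f, hf⟩ := Module.exists_dual_forall_apply_ne_zero (K := ℂ) p hp.1
  obtain ⟨m, hm⟩ : ∃ m : Fin 3 → ℂ, ∀ i, m ⬝ᵥ p i ≠ 0 := by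
    refine ⟨fun k => f fun j => if k = j then 1 else 0, fun i => ?_⟩
    have := hf i
    rw [LinearMap.pi_apply_eq_sum_univ] at this
    simpa only [dotProduct, smul_eq_mul, mul_comm] using this
  set A : Fin 3 → ℂ := (m ⬝ᵥ p i₀)⁻¹ • p i₀ with hA
  set B : Fin 3 → ℂ := w ⨯₃ m with hB
  have hmA : m ⬝ᵥ A = 1 := by rw [hA, dotProduct_smul, smul_eq_mul, inv_mul_cancel₀ (hm i₀)]
  have hwA : w ⬝ᵥ A = 0 := by rw [hA, dotProduct_smul, hi₀, smul_zero]
  have hmB : m ⬝ᵥ B = 0 := dot_cross_self w m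
  have hAB : A ⨯₃ B = w := by
    rw [hB, cross_cross_eq_smul_sub_smul', dotProduct_comm A, hmA, hwA]
    simp
  have hB0 : B ≠ 0 := by
    intro h
    rw [h] at hAB
    exact hw (by simpa using hAB.symm)
  have ht (i : Fin 9) (hi : w ⬝ᵥ p i = 0) : ∃ t : ℂ, A + t • B = (m ⬝ᵥ p i)⁻¹ • p i := by
    obtain ⟨t, ht⟩ := exists_eq_smul_of_cross_eq_zero
      (a := (m ⬝ᵥ p i)⁻¹ • p i - A) (b := B) (by
        rw [hB, cross_cross_eq_smul_sub_smul', dotProduct_comm _ m, dotProduct_sub, hmA,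
          dotProduct_smul, dotProduct_sub, dotProduct_smul, hi, hwA, smul_eq_mul,
          inv_mul_cancel₀ (hm i)]
        simp) hB0
    exact ⟨t, by rw [← ht]; abel⟩
  choose! t ht using ht
  have hinj : Set.InjOn t (Finset.univ.filter fun i => w ⬝ᵥ p i = 0) := by
    intro i hi j hj hij
    by_contra hne
    refine hp.cross_ne_zero hne ?_
    have h : (m ⬝ᵥ p i)⁻¹ • p i = (m ⬝ᵥ p j)⁻¹ • p j := by
      rw [← ht i (by simpa using hi), ← ht j (by simpa using hj), hij]
    have h' : p i = (m ⬝ᵥ p i) • (m ⬝ᵥ p j)⁻¹ • p j := by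
      rw [← h, smul_inv_smul₀ (hm i)]
    rw [h', map_smul, map_smul, LinearMap.smul_apply, LinearMap.smul_apply, cross_self,
      smul_zero, smul_zero]
  have hφ (s : ℂ) : (fun k => (Polynomial.C (A k) + Polynomial.C (B k) * Polynomial.X).eval s)
      = A + s • B := by
    ext k
    simp only [Polynomial.eval_add, Polynomial.eval_mul, Polynomial.eval_C, Polynomial.eval_X,
      Pi.add_apply, Pi.smul_apply, smul_eq_mul, mul_comm]
  refine hp.false_of_curve hF hG
    (fun k => Polynomial.C (A k) + Polynomial.C (B k) * Polynomial.X) (n := 1)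
    (fun k => by compute_degree)
    ((Finset.univ.filter fun i => w ⬝ᵥ p i = 0).image t) ?_ ?_ Set.univ Set.infinite_univ ?_ ?_
  · rw [Finset.card_image_of_injOn hinj]
    lia
  · intro s hs
    obtain ⟨i, hi, rfl⟩ := Finset.mem_image.mp hs
    exact ⟨i, _, (hφ _).trans (ht i (by simpa using hi))⟩
  · intro s _ h
    rw [hφ] at h
    have : m ⬝ᵥ (A + s • B) = 1 := by simp [hmA, hmB]
    rw [h] at this
    simp at this
  · intro s _ u _ h
    rw [hφ, hφ] at h
    have h' : (u - s) • w = 0 := by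
      rw [← h, ← hAB]
      simp only [map_add, LinearMap.add_apply, map_smul, LinearMap.smul_apply, cross_self]
      rw [← cross_anticomm A B]
      module
    have := (smul_eq_zero.mp h').resolve_right hw
    exact (sub_eq_zero.mp this).symm

/-! ### Linear conditions imposed by points on forms of degree `d` -/

/-- `c` is a linear relation between the evaluations at the points `p i` on forms of degree `d`. -/
def IsRelation {ι : Type*} [Fintype ι] (p : ι → Fin 3 → ℂ) (d : ℕ) (c : ι → ℂ) : Prop :=
  ∀ H : MvPolynomial (Fin 3) ℂ, H.IsHomogeneous d → ∑ i, c i * MvPolynomial.eval (p i) H = 0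

lemma IsRelation.mul_linForm {ι : Type*} [Fintype ι] {p : ι → Fin 3 → ℂ} {d : ℕ} {c : ι → ℂ}
    (h : IsRelation p (d + 1) c) (w : Fin 3 → ℂ) :
    IsRelation p d fun i => c i * (w ⬝ᵥ p i) := by
  intro H hH
  rw [← h (H * linForm w) (hH.mul (linForm_isHomogeneous w))]
  refine Finset.sum_congr rfl fun i _ => ?_
  rw [map_mul, eval_linForm]
  ring

/-- At most `d + 1` distinct points impose independent conditions on forms of degree `d`. -/
lemma IsRelation.eq_zero_of_card_le {ι : Type*} [Fintype ι] {p : ι → Fin 3 → ℂ}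
    (hp0 : ∀ i, p i ≠ 0) (hp : ∀ i j, i ≠ j → p i ⨯₃ p j ≠ 0) {d : ℕ} {c : ι → ℂ}
    (h : IsRelation p d c) {S : Finset ι} (hS : ∀ i, c i ≠ 0 → i ∈ S) (hcard : S.card ≤ d + 1) :
    c = 0 := by
  classical
  induction d generalizing c S with
  | zero =>
    ext i
    by_contra hi
    have h1 := h 1 (MvPolynomial.isHomogeneous_one _ _)
    rw [Finset.sum_eq_single i] at h1
    · exact hi (by simpa using h1)
    · intro j _ hji
      by_contra hj
      exact hji (Finset.card_le_one.mp hcard j (hS j (left_ne_zero_of_mul hj)) i (hS i hi))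
    · simp
  | succ d ih =>
    ext i
    by_contra hi
    by_cases hother : ∃ j, j ≠ i ∧ j ∈ S
    · obtain ⟨j, hji, hj⟩ := hother
      obtain ⟨w, hwj, hwi⟩ := exists_dotProduct_eq_zero_ne_zero (hp i j hji.symm)
      have := ih (h.mul_linForm w) (S := S.erase j) (fun l hl => ?_) ?_
      · exact mul_ne_zero hi hwi (congrFun this i)
      · refine Finset.mem_erase.mpr ⟨?_, hS l (left_ne_zero_of_mul hl)⟩
        rintro rfl
        exact right_ne_zero_of_mul hl hwj
      · rw [Finset.card_erase_of_mem hj]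
        lia
    · push Not at hother
      obtain ⟨k, hk⟩ := Function.ne_iff.mp (hp0 i)
      have h1 := h (MvPolynomial.X k ^ (d + 1)) (MvPolynomial.isHomogeneous_X_pow k (d + 1))
      rw [Finset.sum_eq_single i] at h1
      · simp at h1
        exact h1.elim hi hk
      · intro j _ hji
        by_contra hj
        exact hother j hji (hS j (left_ne_zero_of_mul hj))
      · simp

/-- If a line contains at most `d + 1` points of `S`, and the remaining points of `S` impose
independent conditions on forms of degree `d`, then so do those of `S` in degree `d + 1`. -/
lemma IsRelation.eq_zero_of_line {ι : Type*} [Fintype ι] {p : ι → Fin 3 → ℂ}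
    (hp0 : ∀ i, p i ≠ 0) (hp : ∀ i j, i ≠ j → p i ⨯₃ p j ≠ 0) {d : ℕ} {c : ι → ℂ}
    (h : IsRelation p d c) {S : Finset ι} (hS : ∀ i, c i ≠ 0 → i ∈ S) {w : Fin 3 → ℂ}
    (hw : (fun i => c i * (w ⬝ᵥ p i)) = 0)
    (hcard : (S.filter fun i => w ⬝ᵥ p i = 0).card ≤ d + 1) : c = 0 :=
  h.eq_zero_of_card_le hp0 hp (S := S.filter fun i => w ⬝ᵥ p i = 0)
    (fun i hi => Finset.mem_filter.mpr
      ⟨hS i hi, (mul_eq_zero.mp (congrFun hw i)).resolve_left hi⟩) hcard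

/-- At most `2 * d + 1` distinct points, no `d + 2` of which are collinear, impose independent
conditions on forms of degree `d`. -/
lemma IsRelation.eq_zero_of_line_card_le {ι : Type*} [Fintype ι] {p : ι → Fin 3 → ℂ}
    (hp0 : ∀ i, p i ≠ 0) (hp : ∀ i j, i ≠ j → p i ⨯₃ p j ≠ 0) {d : ℕ} {c : ι → ℂ}
    (h : IsRelation p d c) {S : Finset ι} (hS : ∀ i, c i ≠ 0 → i ∈ S)
    (hcard : S.card ≤ 2 * d + 1)
    (hline : ∀ w : Fin 3 → ℂ, w ≠ 0 → (S.filter fun i => w ⬝ᵥ p i = 0).card ≤ d + 1) :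
    c = 0 := by
  classical
  induction d generalizing c S with
  | zero => exact h.eq_zero_of_card_le hp0 hp hS hcard
  | succ d ih =>
    have hS' (w : Fin 3 → ℂ) (i : ι) (hi : c i * (w ⬝ᵥ p i) ≠ 0) :
        i ∈ S.filter fun i => ¬ w ⬝ᵥ p i = 0 :=
      Finset.mem_filter.mpr ⟨hS i (left_ne_zero_of_mul hi), right_ne_zero_of_mul hi⟩
    have hsplit (w : Fin 3 → ℂ) :=
      Finset.card_filter_add_card_filter_not (s := S) (fun i => w ⬝ᵥ p i = 0)
    by_cases hmax : ∃ w : Fin 3 → ℂ, w ≠ 0 ∧ d + 2 ≤ (S.filter fun i => w ⬝ᵥ p i = 0).card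
    · obtain ⟨w, hw, hwcard⟩ := hmax
      refine h.eq_zero_of_line hp0 hp hS (w := w) ?_ (hline w hw)
      refine (h.mul_linForm w).eq_zero_of_card_le hp0 hp (hS' w) ?_
      have := hsplit w
      lia
    · push Not at hmax
      by_cases hsmall : S.card ≤ d + 2
      · exact h.eq_zero_of_card_le hp0 hp hS hsmall
      obtain ⟨i, hi, j, hj, hij⟩ := Finset.one_lt_card.mp (by lia : 1 < S.card)
      have hw := hp i j hij
      refine h.eq_zero_of_line hp0 hp hS (w := p i ⨯₃ p j) ?_ (hline _ hw)
      refine ih (h.mul_linForm _) (hS' _) ?_ fun u hu => ?_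
      · have h2 : 2 ≤ (S.filter fun l => (p i ⨯₃ p j) ⬝ᵥ p l = 0).card := by
          rw [← Finset.card_pair hij]
          refine Finset.card_le_card fun l hl => ?_
          rcases Finset.mem_insert.mp hl with rfl | hl
          · exact Finset.mem_filter.mpr ⟨hi, by rw [dotProduct_comm, dot_self_cross]⟩
          · rw [Finset.mem_singleton.mp hl]
            exact Finset.mem_filter.mpr ⟨hj, by rw [dotProduct_comm, dot_cross_self]⟩
        have := hsplit (p i ⨯₃ p j)
        lia
      · exact (Finset.card_le_card (Finset.filter_subset_filter _ (Finset.filter_subset _ _))).trans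
          (Nat.lt_succ_iff.mp (hmax u hu))

/-! ### Eight points -/

/-- The determinant of three vectors of `ℂ³`. -/
def bracket (a b x : Fin 3 → ℂ) : ℂ := (a ⨯₃ b) ⬝ᵥ x

lemma bracket_apply (a b x : Fin 3 → ℂ) :
    bracket a b x = (a 1 * b 2 - a 2 * b 1) * x 0 + (a 2 * b 0 - a 0 * b 2) * x 1
      + (a 0 * b 1 - a 1 * b 0) * x 2 := by
  simp [bracket, cross_apply, dotProduct, Fin.sum_univ_three]

lemma bracket_smul_eq (a b c x : Fin 3 → ℂ) :
    bracket a b c • x = bracket b c x • a + bracket c a x • b + bracket a b x • c := by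
  ext k
  fin_cases k <;> simp [bracket_apply] <;> ring

lemma bracket_mul_sub_mul (a b c x y : Fin 3 → ℂ) :
    bracket c a x * bracket b c y - bracket c a y * bracket b c x
      = bracket a b c * bracket y x c := by
  simp only [bracket_apply]
  ring

/-- In a relation between cubic forms at eight points, the first three points and two others can
be eliminated by a product of three lines. -/
lemma IsRelation.sum_eq_zero {r : Fin 8 → Fin 3 → ℂ} {c : Fin 8 → ℂ} (h : IsRelation r 3 c)
    (u v w : Fin 3 → ℂ) : ∑ i, c i * ((u ⬝ᵥ r i) * (v ⬝ᵥ r i) * (w ⬝ᵥ r i)) = 0 := by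
  rw [← ((h.mul_linForm u).mul_linForm v).mul_linForm w 1 (MvPolynomial.isHomogeneous_one _ _)]
  refine Finset.sum_congr rfl fun i _ => ?_
  rw [map_one]
  ring

/-- Eight points, no three of which are collinear, that fail to impose independent conditions on
cubics lie on a nondegenerate conic through the first three points. -/
lemma IsRelation.exists_conic {r : Fin 8 → Fin 3 → ℂ} {c : Fin 8 → ℂ} (h : IsRelation r 3 c)
    (hc : ∀ i, c i ≠ 0)
    (hr : ∀ i j k, i ≠ j → i ≠ k → j ≠ k → bracket (r i) (r j) (r k) ≠ 0) :
    ∃ a b e : ℂ, a ≠ 0 ∧ b ≠ 0 ∧ e ≠ 0 ∧ ∀ i, 3 ≤ i →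
      a * (bracket (r 2) (r 0) (r i) * bracket (r 0) (r 1) (r i))
      + b * (bracket (r 1) (r 2) (r i) * bracket (r 0) (r 1) (r i))
      + e * (bracket (r 1) (r 2) (r i) * bracket (r 2) (r 0) (r i)) = 0 := by
  set α : Fin 8 → ℂ := fun i => bracket (r 1) (r 2) (r i) with hα
  set β : Fin 8 → ℂ := fun i => bracket (r 2) (r 0) (r i) with hβ
  set γ : Fin 8 → ℂ := fun i => bracket (r 0) (r 1) (r i) with hγ
  have bself (x y : Fin 3 → ℂ) : bracket x y x = 0 ∧ bracket x y y = 0 := by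
    constructor <;> simp only [bracket_apply] <;> ring
  have hα3 : α 3 ≠ 0 := hr _ _ _ (by decide) (by decide) (by decide)
  have hα4 : α 4 ≠ 0 := hr _ _ _ (by decide) (by decide) (by decide)
  have hβ3 : β 3 ≠ 0 := hr _ _ _ (by decide) (by decide) (by decide)
  have hβ4 : β 4 ≠ 0 := hr _ _ _ (by decide) (by decide) (by decide)
  have hγ3 : γ 3 ≠ 0 := hr _ _ _ (by decide) (by decide) (by decide)
  have hγ4 : γ 4 ≠ 0 := hr _ _ _ (by decide) (by decide) (by decide)
  have hD : bracket (r 0) (r 1) (r 2) ≠ 0 := hr _ _ _ (by decide) (by decide) (by decide)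
  have key (l j k : Fin 8) (hlj : l ≠ j) (hlk : l ≠ k) (hjk : j ≠ k)
      (hsum : ∀ f : Fin 8 → ℂ, f 0 = 0 → f 1 = 0 → f 2 = 0 → f j = 0 → f k = 0 →
        ∑ i, f i = f 3 + f 4 + f l) :
      α 3 * α 4 * (γ 3 * β 4 - γ 4 * β 3) * (β l * γ l)
      + β 3 * β 4 * (α 3 * γ 4 - α 4 * γ 3) * (α l * γ l)
      + γ 3 * γ 4 * (β 3 * α 4 - β 4 * α 3) * (α l * β l) = 0 := by
    have hcl := mul_ne_zero (hc l) (hr j k l hjk hlj.symm hlk.symm)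
    have h1 := h.sum_eq_zero (r 2 ⨯₃ r 0) (r 0 ⨯₃ r 1) (r j ⨯₃ r k)
    have h2 := h.sum_eq_zero (r 1 ⨯₃ r 2) (r 0 ⨯₃ r 1) (r j ⨯₃ r k)
    have h3 := h.sum_eq_zero (r 1 ⨯₃ r 2) (r 2 ⨯₃ r 0) (r j ⨯₃ r k)
    change ∑ i, c i * (β i * γ i * bracket (r j) (r k) (r i)) = 0 at h1
    change ∑ i, c i * (α i * γ i * bracket (r j) (r k) (r i)) = 0 at h2
    change ∑ i, c i * (α i * β i * bracket (r j) (r k) (r i)) = 0 at h3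
    rw [hsum _ (by simp [α, β, γ, bself]) (by simp [α, β, γ, bself]) (by simp [α, β, γ, bself])
      (by simp [bself]) (by simp [bself])] at h1 h2 h3
    refine (mul_eq_zero.mp ?_).resolve_left hcl
    simp only [hα, hβ, hγ]
    linear_combination
      (bracket (r 1) (r 2) (r 3) * bracket (r 1) (r 2) (r 4)
        * (bracket (r 0) (r 1) (r 3) * bracket (r 2) (r 0) (r 4)
          - bracket (r 0) (r 1) (r 4) * bracket (r 2) (r 0) (r 3))) * h1
      + (bracket (r 2) (r 0) (r 3) * bracket (r 2) (r 0) (r 4)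
        * (bracket (r 1) (r 2) (r 3) * bracket (r 0) (r 1) (r 4)
          - bracket (r 1) (r 2) (r 4) * bracket (r 0) (r 1) (r 3))) * h2
      + (bracket (r 0) (r 1) (r 3) * bracket (r 0) (r 1) (r 4)
        * (bracket (r 2) (r 0) (r 3) * bracket (r 1) (r 2) (r 4)
          - bracket (r 2) (r 0) (r 4) * bracket (r 1) (r 2) (r 3))) * h3
  have hcoef {a b e x y : Fin 3 → ℂ} (hD : bracket a b e ≠ 0) (hyx : bracket y x e ≠ 0) :
      bracket e a x * bracket b e y - bracket e a y * bracket b e x ≠ 0 := by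
    rw [bracket_mul_sub_mul]
    exact mul_ne_zero hD hyx
  refine ⟨α 3 * α 4 * (γ 3 * β 4 - γ 4 * β 3), β 3 * β 4 * (α 3 * γ 4 - α 4 * γ 3),
    γ 3 * γ 4 * (β 3 * α 4 - β 4 * α 3), ?_, ?_, ?_, fun i hi => ?_⟩
  · exact mul_ne_zero (mul_ne_zero hα3 hα4) (hcoef
      (hr 1 2 0 (by decide) (by decide) (by decide)) (hr _ _ _ (by decide) (by decide) (by decide)))
  · exact mul_ne_zero (mul_ne_zero hβ3 hβ4) (hcoef
      (hr 2 0 1 (by decide) (by decide) (by decide)) (hr _ _ _ (by decide) (by decide) (by decide)))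
  · exact mul_ne_zero (mul_ne_zero hγ3 hγ4) (hcoef
      (hr 0 1 2 (by decide) (by decide) (by decide)) (hr _ _ _ (by decide) (by decide) (by decide)))
  · obtain rfl | rfl | rfl | rfl | rfl : i = 3 ∨ i = 4 ∨ i = 5 ∨ i = 6 ∨ i = 7 := by
      revert i
      decide
    · ring
    · ring
    · exact key 5 6 7 (by decide) (by decide) (by decide) fun f h0 h1 h2 h6 h7 => by
        simp [Fin.sum_univ_eight, h0, h1, h2, h6, h7]
    · exact key 6 5 7 (by decide) (by decide) (by decide) fun f h0 h1 h2 h5 h7 => by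
        simp [Fin.sum_univ_eight, h0, h1, h2, h5, h7]
    · exact key 7 5 6 (by decide) (by decide) (by decide) fun f h0 h1 h2 h5 h6 => by
        simp [Fin.sum_univ_eight, h0, h1, h2, h5, h6]

/-- Eight of the nine points, no three of which are collinear, do not all occur in a relation. -/
lemma NinePoints.false_of_relation {F G : MvPolynomial (Fin 3) ℂ} {p : Fin 9 → Fin 3 → ℂ}
    (hp : NinePoints F G p) (hF : IsCubic F) (hG : IsCubic G) {q : Fin 8 → Fin 9}
    {c : Fin 8 → ℂ} (h : IsRelation (fun i => p (q i)) 3 c) (hc : ∀ i, c i ≠ 0)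
    (hr : ∀ i j k, i ≠ j → i ≠ k → j ≠ k → bracket (p (q i)) (p (q j)) (p (q k)) ≠ 0) :
    False := by
  classical
  obtain ⟨a, b, e, ha, hb, he, hconic⟩ := h.exists_conic hc hr
  set r : Fin 8 → Fin 3 → ℂ := fun i => p (q i) with hr_def
  set D := bracket (r 0) (r 1) (r 2) with hD_def
  have hD : D ≠ 0 := hr _ _ _ (by decide) (by decide) (by decide)
  set α : Fin 8 → ℂ := fun i => bracket (r 1) (r 2) (r i) with hα
  set β : Fin 8 → ℂ := fun i => bracket (r 2) (r 0) (r i) with hβ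
  set γ : Fin 8 → ℂ := fun i => bracket (r 0) (r 1) (r i) with hγ
  have hne {i : Fin 8} (hi : 3 ≤ i) : i ≠ 0 ∧ i ≠ 1 ∧ i ≠ 2 := by
    revert i
    decide
  have hα0 {i : Fin 8} (hi : 3 ≤ i) : α i ≠ 0 :=
    hr _ _ _ (by decide) (hne hi).2.1.symm (hne hi).2.2.symm
  have hβ0 {i : Fin 8} (hi : 3 ≤ i) : β i ≠ 0 :=
    hr _ _ _ (by decide) (hne hi).2.2.symm (hne hi).1.symm
  have hγ0 {i : Fin 8} (hi : 3 ≤ i) : γ i ≠ 0 :=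
    hr _ _ _ (by decide) (hne hi).1.symm (hne hi).2.1.symm
  replace hconic {i : Fin 8} (hi : 3 ≤ i) :
      a * (β i * γ i) + b * (α i * γ i) + e * (α i * β i) = 0 := hconic i hi
  set φ : Fin 3 → ℂ[X] := fun k =>
    Polynomial.C (-(b * r 0 k)) + Polynomial.C (e * r 2 k - a * r 0 k - b * r 1 k) * Polynomial.X
      + Polynomial.C (-(a * r 1 k)) * Polynomial.X ^ 2 with hφ_def
  have hφ (t : ℂ) : (fun k => (φ k).eval t) =
      (-(a * t + b)) • r 0 + (-(t * (a * t + b))) • r 1 + (e * t) • r 2 := by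
    ext k
    simp only [hφ_def, Polynomial.eval_add, Polynomial.eval_mul, Polynomial.eval_C,
      Polynomial.eval_X, Polynomial.eval_pow, Pi.add_apply, Pi.smul_apply, smul_eq_mul]
    ring
  have hαφ (t : ℂ) : bracket (r 1) (r 2) (fun k => (φ k).eval t) = -(a * t + b) * D := by
    rw [hφ, hD_def]
    simp only [bracket_apply, Pi.add_apply, Pi.smul_apply, smul_eq_mul]
    ring
  have hβφ (t : ℂ) : bracket (r 2) (r 0) (fun k => (φ k).eval t) = -(t * (a * t + b)) * D := by
    rw [hφ, hD_def]
    simp only [bracket_apply, Pi.add_apply, Pi.smul_apply, smul_eq_mul]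
    ring
  set τ : Fin 8 → ℂ := fun i => β i / α i with hτ
  have hτφ {i : Fin 8} (hi : 3 ≤ i) :
      (fun k => (φ k).eval (τ i)) = (e * β i / (γ i * α i) * D) • r i := by
    have hα0 := hα0 hi
    have hβ0 := hβ0 hi
    have hγ0 := hγ0 hi
    have hlin : a * τ i + b = -(e * β i / γ i) := by
      rw [hτ]
      field_simp
      linear_combination hconic hi
    have hcramer : D • r i = α i • r 0 + β i • r 1 + γ i • r 2 := bracket_smul_eq _ _ _ _
    rw [hφ, hlin, mul_smul _ D, hcramer, smul_add, smul_add, smul_smul, smul_smul, smul_smul]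
    congr 2
    · congr 1
      field_simp
    · congr 1
      simp only [hτ]
      field_simp
    · simp only [hτ]
      field_simp
  have h3 (i : Fin 8) (hi : i ∈ ({3, 4, 5, 6, 7} : Finset (Fin 8))) : 3 ≤ i := by
    revert i
    decide
  have hτinj : Set.InjOn τ ({3, 4, 5, 6, 7} : Finset (Fin 8)) := by
    intro i hi j hj hij
    by_contra hne'
    have hi' : 3 ≤ i := h3 i hi
    have hj' : 3 ≤ j := h3 j hj
    have h1 := bracket_mul_sub_mul (r 0) (r 1) (r 2) (r i) (r j)
    refine mul_ne_zero hD (hr j i 2 (Ne.symm hne') (hne hj').2.2 (hne hi').2.2) (h1.symm.trans ?_)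
    exact sub_eq_zero.mpr ((div_eq_div_iff (hα0 hi') (hα0 hj')).mp hij)
  have hlin0 {t : ℂ} (ht : t = -b / a) : a * t + b = 0 := by
    rw [ht]
    field_simp
    ring
  have hτ0 {i : Fin 8} (hi : 3 ≤ i) : τ i ≠ 0 := div_ne_zero (hβ0 hi) (hα0 hi)
  have hτb {i : Fin 8} (hi : 3 ≤ i) : τ i ≠ -b / a := by
    intro hib
    have h1 := hαφ (τ i)
    rw [hlin0 hib, hτφ hi] at h1
    refine mul_ne_zero (mul_ne_zero (div_ne_zero (mul_ne_zero he (hβ0 hi))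
      (mul_ne_zero (hγ0 hi) (hα0 hi))) hD) (hα0 hi) ?_
    rwa [bracket, dotProduct_smul, smul_eq_mul, neg_zero, zero_mul] at h1
  refine hp.false_of_curve hF hG φ (n := 2) (fun k => by simp only [hφ_def]; compute_degree)
    (insert 0 (insert (-b / a) (({3, 4, 5, 6, 7} : Finset (Fin 8)).image τ))) ?_ ?_
    {t | a * t + b = 0}ᶜ ?_ ?_ ?_
  · rw [Finset.card_insert_of_notMem, Finset.card_insert_of_notMem,
      Finset.card_image_of_injOn hτinj]
    · decide
    · intro hmem
      obtain ⟨i, hi, hib⟩ := Finset.mem_image.mp hmem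
      exact hτb (h3 i hi) hib
    · intro hmem
      rcases Finset.mem_insert.mp hmem with h0 | hmem
      · exact div_ne_zero (neg_ne_zero.mpr hb) ha h0.symm
      · obtain ⟨i, hi, hib⟩ := Finset.mem_image.mp hmem
        exact hτ0 (h3 i hi) hib
  · intro t ht
    rcases Finset.mem_insert.mp ht with rfl | ht
    · exact ⟨q 0, -b, by rw [hφ]; simp [hr_def]⟩
    rcases Finset.mem_insert.mp ht with rfl | ht
    · exact ⟨q 2, e * (-b / a), by rw [hφ, hlin0 rfl]; simp [hr_def]⟩
    · obtain ⟨i, hi, rfl⟩ := Finset.mem_image.mp ht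
      exact ⟨q i, _, hτφ (h3 i hi)⟩
  · refine Set.Finite.infinite_compl ((Set.finite_singleton (-b / a)).subset fun t ht => ?_)
    have ht' : a * t + b = 0 := ht
    rw [Set.mem_singleton_iff]
    field_simp
    linear_combination ht'
  · intro t ht h0
    have h1 := hαφ t
    rw [h0] at h1
    have h2 : -(a * t + b) * D = 0 := by simpa [bracket] using h1.symm
    exact mul_ne_zero (neg_ne_zero.mpr ht) hD h2
  · intro s hs t ht hst
    have h1 := bracket_mul_sub_mul (r 0) (r 1) (r 2) (fun k => (φ k).eval t)
      (fun k => (φ k).eval s)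
    have h2 : bracket (fun k => (φ k).eval s) (fun k => (φ k).eval t) (r 2) = 0 := by
      rw [bracket, hst, zero_dotProduct]
    rw [h2, hαφ, hαφ, hβφ, hβφ, mul_zero] at h1
    have h4 : ((a * s + b) * (a * t + b) * D ^ 2) * (s - t) = 0 := by
      linear_combination -h1
    exact sub_eq_zero.mp ((mul_eq_zero.mp h4).resolve_left
      (mul_ne_zero (mul_ne_zero hs ht) (pow_ne_zero 2 hD)))

/-- Any eight of the nine points impose independent conditions on cubics. -/
lemma NinePoints.relation_eq_zero {F G : MvPolynomial (Fin 3) ℂ} {p : Fin 9 → Fin 3 → ℂ}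
    (hp : NinePoints F G p) (hF : IsCubic F) (hG : IsCubic G) {c : Fin 9 → ℂ}
    (h : IsRelation p 3 c) {j : Fin 9} (hj : c j = 0) : c = 0 := by
  classical
  have hp' : ∀ i j, i ≠ j → p i ⨯₃ p j ≠ 0 := fun _ _ => hp.cross_ne_zero
  set S := Finset.univ.filter fun i => c i ≠ 0 with hS_def
  have hS (i : Fin 9) (hi : c i ≠ 0) : i ∈ S := by simpa [hS_def] using hi
  have hline {w : Fin 3 → ℂ} (hw : w ≠ 0) (T : Finset (Fin 9)) :
      (T.filter fun i => w ⬝ᵥ p i = 0).card ≤ 3 :=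
    (Finset.card_le_card (Finset.filter_subset_filter _ (Finset.subset_univ T))).trans
      (hp.card_line_le hF hG hw)
  have hS8 : S.card ≤ 8 := by
    have : S ⊆ Finset.univ.erase j := fun i hi =>
      Finset.mem_erase.mpr ⟨fun hij => (Finset.mem_filter.mp hi).2 (hij ▸ hj), Finset.mem_univ i⟩
    simpa using Finset.card_le_card this
  by_cases hthree : ∃ w : Fin 3 → ℂ, w ≠ 0 ∧ 3 ≤ (S.filter fun i => w ⬝ᵥ p i = 0).card
  · obtain ⟨w, hw, hwcard⟩ := hthree
    refine h.eq_zero_of_line hp.1 hp' hS (w := w) ?_ ((hline hw S).trans (by decide))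
    refine (h.mul_linForm w).eq_zero_of_line_card_le hp.1 hp'
      (S := S.filter fun i => ¬ w ⬝ᵥ p i = 0) (fun i hi => Finset.mem_filter.mpr
        ⟨hS i (left_ne_zero_of_mul hi), right_ne_zero_of_mul hi⟩) ?_ fun u hu => hline hu _
    have := Finset.card_filter_add_card_filter_not (s := S) (fun i => w ⬝ᵥ p i = 0)
    lia
  by_cases hS7 : S.card ≤ 7
  · exact h.eq_zero_of_line_card_le hp.1 hp' hS hS7
      fun w hw => (hline hw S).trans (by decide)
  have hc (i : Fin 9) (hi : i ≠ j) : c i ≠ 0 := by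
    intro hi0
    refine hS7 ?_
    have : S ⊆ (Finset.univ.erase j).erase i := fun l hl =>
      Finset.mem_erase.mpr ⟨fun hl' => (Finset.mem_filter.mp hl).2 (hl' ▸ hi0),
        Finset.mem_erase.mpr ⟨fun hl' => (Finset.mem_filter.mp hl).2 (hl' ▸ hj),
          Finset.mem_univ l⟩⟩
    have := Finset.card_le_card this
    rwa [Finset.card_erase_of_mem (by simpa using hi),
      Finset.card_erase_of_mem (Finset.mem_univ j), Finset.card_fin] at this
  refine (hp.false_of_relation hF hG (q := j.succAbove) (c := fun i => c (j.succAbove i))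
    (fun H hH => ?_) (fun i => hc _ (Fin.succAbove_ne j i)) fun i k l hik hil hkl h0 => ?_).elim
  · have := h H hH
    rwa [Fin.sum_univ_succAbove _ j, hj, zero_mul, zero_add] at this
  · have hinj := Fin.succAbove_right_injective (p := j)
    refine hthree ⟨_, hp' _ _ (hinj.ne hik), ?_⟩
    have hcard : ({j.succAbove i, j.succAbove k, j.succAbove l} : Finset (Fin 9)).card = 3 :=
      Finset.card_eq_three.mpr ⟨_, _, _, hinj.ne hik, hinj.ne hil, hinj.ne hkl, rfl⟩
    refine hcard.symm.trans_le (Finset.card_le_card fun m hm => ?_)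
    simp only [Finset.mem_insert, Finset.mem_singleton] at hm
    rcases hm with rfl | rfl | rfl
    · exact Finset.mem_filter.mpr ⟨hS _ (hc _ (Fin.succAbove_ne j _)),
        by rw [dotProduct_comm, dot_self_cross]⟩
    · exact Finset.mem_filter.mpr ⟨hS _ (hc _ (Fin.succAbove_ne j _)),
        by rw [dotProduct_comm, dot_cross_self]⟩
    · exact Finset.mem_filter.mpr ⟨hS _ (hc _ (Fin.succAbove_ne j _)), h0⟩

/-- Among the nine points, for `i ≠ j`, some cubic form vanishes at all points other than the
`i`-th and `j`-th ones, but not at the `i`-th one. -/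
lemma NinePoints.exists_separating {F G : MvPolynomial (Fin 3) ℂ} {p : Fin 9 → Fin 3 → ℂ}
    (hp : NinePoints F G p) (hF : IsCubic F) (hG : IsCubic G) {i j : Fin 9} (hij : i ≠ j) :
    ∃ H : MvPolynomial (Fin 3) ℂ, H.IsHomogeneous 3 ∧
      (∀ l, l ≠ i → l ≠ j → MvPolynomial.eval (p l) H = 0) ∧
      MvPolynomial.eval (p i) H ≠ 0 := by
  classical
  by_contra! hcon
  let V := MvPolynomial.homogeneousSubmodule (Fin 3) ℂ 3
  let ev (l : Fin 9) : V →ₗ[ℂ] ℂ := (MvPolynomial.aeval (p l)).toLinearMap ∘ₗ V.subtype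
  have hev (l : Fin 9) (H : V) : ev l H = MvPolynomial.eval (p l) H.1 := by
    simp [ev, MvPolynomial.aeval_eq_eval]
  have hspan : ev i ∈ Submodule.span ℂ
      (Set.range fun l : {l : Fin 9 // l ≠ i ∧ l ≠ j} => ev l) := by
    refine mem_span_of_iInf_ker_le_ker fun H hH => ?_
    rw [LinearMap.mem_ker, hev]
    refine hcon H.1 H.2 fun l hli hlj => ?_
    rw [← hev]
    exact LinearMap.mem_ker.mp ((Submodule.mem_iInf _).mp hH ⟨l, hli, hlj⟩)
  obtain ⟨d, hd⟩ := (Submodule.mem_span_range_iff_exists_fun ℂ).mp hspan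
  let c (l : Fin 9) : ℂ := if hl : l ≠ i ∧ l ≠ j then d ⟨l, hl⟩ else if l = i then -1 else 0
  have hci : c i = -1 := by simp [c]
  have hcj : c j = 0 := by simp [c, hij.symm]
  have hrel : IsRelation p 3 c := by
    intro H hH
    have h1 := LinearMap.congr_fun hd ⟨H, hH⟩
    simp only [LinearMap.sum_apply, LinearMap.smul_apply, hev, smul_eq_mul] at h1
    rw [← Finset.add_sum_erase _ _ (Finset.mem_univ i), hci, ← h1,
      ← Finset.add_sum_erase _ _ (Finset.mem_erase.mpr ⟨hij.symm, Finset.mem_univ j⟩), hcj]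
    have h2 : ∑ l : {l : Fin 9 // l ≠ i ∧ l ≠ j}, d l * MvPolynomial.eval (p l) H
        = ∑ l ∈ (Finset.univ.erase i).erase j, c l * MvPolynomial.eval (p l) H := by
      rw [Finset.sum_subtype (p := fun l => l ≠ i ∧ l ≠ j) _ (by simp [and_comm])]
      refine Finset.sum_congr rfl fun l _ => ?_
      simp [c, l.2.1, l.2.2]
    rw [h2]
    ring
  have := congrFun (hp.relation_eq_zero hF hG hrel hcj) i
  simp [hci] at this

/-- For every `2 ≤ k ≤ 9` there is a cubic vanishing at `p_{k+1}, …, p₉`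
(geometric indices; here the points `p i` with `k ≤ i`) and not vanishing at
any of `p₁, …, p_k` (here the points `p i` with `i < k`). -/
theorem exists_cubic_through_last_points_avoiding_first
    (F G : MvPolynomial (Fin 3) ℂ) (hF : SmoothCubic F) (hG : SmoothCubic G)
    (p : Fin 9 → Fin 3 → ℂ) (hp : NinePoints F G p)
    (htrans : ∀ i, Transverse F G (p i)) :
    ∀ k : ℕ, 2 ≤ k → k ≤ 9 →
      ∃ H : MvPolynomial (Fin 3) ℂ, IsCubic H ∧
        (∀ i : Fin 9, k ≤ (i : ℕ) → eval (p i) H = 0) ∧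
        (∀ i : Fin 9, (i : ℕ) < k → eval (p i) H ≠ 0) := by
  intro k hk _
  let V : Submodule ℂ (MvPolynomial (Fin 3) ℂ) := MvPolynomial.homogeneousSubmodule (Fin 3) ℂ 3 ⊓
    ⨅ i : {i : Fin 9 // k ≤ (i : ℕ)}, LinearMap.ker (MvPolynomial.aeval (p i)).toLinearMap
  have hV (H : MvPolynomial (Fin 3) ℂ) : H ∈ V ↔
      H.IsHomogeneous 3 ∧ ∀ i : Fin 9, k ≤ (i : ℕ) → MvPolynomial.eval (p i) H = 0 := by
    simp [V, MvPolynomial.aeval_eq_eval]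
  obtain ⟨H, hH, hne⟩ := Module.Dual.exists_forall_mem_ne_zero_of_forall_exists V
    (fun i : {i : Fin 9 // (i : ℕ) < k} => (MvPolynomial.aeval (p i)).toLinearMap) (by
      rintro ⟨i, hi⟩
      obtain ⟨j, hj, hij⟩ : ∃ j : Fin 9, (j : ℕ) < k ∧ i ≠ j := by
        by_cases h0 : i = 0
        · exact ⟨1, hk, by simp [h0]⟩
        · exact ⟨0, by simp; lia, h0⟩
      obtain ⟨H, hH, hvan, hne⟩ := hp.exists_separating hF.1 hG.1 hij
      refine ⟨H, (hV H).mpr ⟨hH, fun l hl => hvan l ?_ ?_⟩, by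
        simpa [MvPolynomial.aeval_eq_eval] using hne⟩
      · rintro rfl
        lia
      · rintro rfl
        lia)
  obtain ⟨hhom, hvan⟩ := (hV H).mp hH
  have hne' (i : Fin 9) (hi : (i : ℕ) < k) : MvPolynomial.eval (p i) H ≠ 0 := by
    simpa [MvPolynomial.aeval_eq_eval] using hne ⟨i, hi⟩
  refine ⟨H, ⟨?_, hhom⟩, hvan, hne'⟩
  rintro rfl
  exact hne' 0 (by simp; lia) (map_zero _)
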